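/- Let n be a positive integer, Ω ⊆ ℂⁿ an open set, and let (h_k)_{k=1}^∞ be a sequence of holomorphic functions h_k : Ω → ℂ that converges pointwise on Ω to a function h : Ω → ℂ. Then there exists an open set U ⊆ Ω that is dense in Ω such that h is holomorphic on U, and the convergence h_k → h is uniform on every compact subset of U. -/

import Mathlib

open Set Filter Topology Metric

/-- On a Baire space, a pointwise bounded family of continuous functions is locally uniformly
bounded on a dense open set. -/
theorem exists_isOpen_dense_locally_bounded {X F ι : Type*} [TopologicalSpace X] [BaireSpace X]
    [SeminormedAddCommGroup F] {h : ι → X → F} (hcont : ∀ k, Continuous (h k))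
    (hbdd : ∀ x, ∃ M : ℝ, ∀ k, ‖h k x‖ ≤ M) :
    ∃ U : Set X, IsOpen U ∧ Dense U ∧ ∀ x ∈ U, ∃ M : ℝ, ∀ᶠ y in 𝓝 x, ∀ k, ‖h k y‖ ≤ M := by
  let A : ℕ → Set X := fun m => {x | ∀ k, ‖h k x‖ ≤ m}
  have hA : ∀ m, IsClosed (A m) := fun m => by
    simp only [A, ofPred_forall]
    exact isClosed_iInter fun k => isClosed_le (hcont k).norm continuous_const
  have hcover : ⋃ m, A m = univ := eq_univ_of_forall fun x => by
    obtain ⟨M, hM⟩ := hbdd x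
    obtain ⟨m, hm⟩ := exists_nat_ge M
    exact mem_iUnion.2 ⟨m, fun k => (hM k).trans hm⟩
  refine ⟨⋃ m, interior (A m), isOpen_iUnion fun m => isOpen_interior,
    dense_iUnion_interior_of_closed hA hcover, fun x hx => ?_⟩
  obtain ⟨m, hm⟩ := mem_iUnion.1 hx
  exact ⟨m, mem_interior_iff_mem_nhds.1 hm⟩

section NormedSpace

variable {E F ι : Type*} [NormedAddCommGroup E] [NormedSpace ℂ E] [NormedAddCommGroup F]
  [NormedSpace ℂ F]

/-- A family of holomorphic functions which is uniformly bounded near a point is equicontinuous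
there. -/
theorem equicontinuousAt_of_differentiableOn_of_bounded {h : ι → E → F} {s : Set E} {x : E} {M : ℝ}
    (hs : s ∈ 𝓝 x) (hd : ∀ k, DifferentiableOn ℂ (h k) s) (hM : ∀ᶠ y in 𝓝 x, ∀ k, ‖h k y‖ ≤ M) :
    EquicontinuousAt h x := by
  obtain ⟨R, hR, hball⟩ := Metric.mem_nhds_iff.1 (inter_mem hs hM)
  refine Metric.equicontinuousAt_of_continuity_modulus (fun y => 2 * M / R * dist y x) ?_ h ?_
  · have : Continuous fun y => 2 * M / R * dist y x := by fun_prop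
    simpa using this.tendsto x
  · filter_upwards [ball_mem_nhds x hR] with y hy k
    rw [dist_comm]
    refine Complex.dist_le_div_mul_dist_of_mapsTo_ball
      ((hd k).mono fun w hw => (hball hw).1) (fun w hw => ?_) hy
    have h₁ := (hball hw).2 k
    have h₂ := (hball (mem_ball_self hR)).2 k
    rw [mem_closedBall, dist_eq_norm]
    linarith [norm_sub_le (h k w) (h k x)]

/-- If a family of holomorphic functions is uniformly Cauchy on a ball, then so are its
derivatives on the concentric ball of half the radius. -/
theorem UniformCauchySeqOn.fderiv_of_differentiableOn {h : ι → E → F} {l : Filter ι} {x : E} {r : ℝ}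
    (hr : 0 < r) (hd : ∀ k, DifferentiableOn ℂ (h k) (ball x (2 * r)))
    (hc : UniformCauchySeqOn h l (ball x (2 * r))) :
    UniformCauchySeqOn (fun k => fderiv ℂ (h k)) l (ball x r) := by
  intro u hu
  obtain ⟨ε, hε, hεu⟩ := Metric.mem_uniformity_dist.1 hu
  have hδ : 0 < ε * r / 4 := by positivity
  filter_upwards [hc _ (Metric.dist_mem_uniformity hδ)] with p hp y hy
  apply hεu
  have hsub : ball y r ⊆ ball x (2 * r) := ball_subset_ball' (by rw [mem_ball] at hy; linarith)
  have hda : ∀ k, DifferentiableAt ℂ (h k) y := fun k =>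
    (hd k).differentiableAt (isOpen_ball.mem_nhds (hsub (mem_ball_self hr)))
  have hle : ‖fderiv ℂ (h p.1 - h p.2) y‖ ≤ (ε * r / 2) / r := by
    refine Complex.norm_fderiv_le_div_of_mapsTo_ball
      (((hd p.1).sub (hd p.2)).mono hsub) (fun w hw => ?_) hr
    have h₁ : dist (h p.1 w) (h p.2 w) < ε * r / 4 := hp w (hsub hw)
    have h₂ : dist (h p.1 y) (h p.2 y) < ε * r / 4 := hp y (hsub (mem_ball_self hr))
    rw [dist_eq_norm] at h₁ h₂
    rw [mem_closedBall, dist_eq_norm, Pi.sub_apply, Pi.sub_apply]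
    linarith [norm_sub_le (h p.1 w - h p.2 w) (h p.1 y - h p.2 y)]
  rw [fderiv_sub (hda _) (hda _)] at hle
  rw [dist_eq_norm]
  refine hle.trans_lt ?_
  rw [div_lt_iff₀ hr]
  nlinarith [mul_pos hε hr]

/-- A locally uniform limit of holomorphic functions on an open subset of a locally
compact complex normed space is holomorphic. -/
theorem TendstoLocallyUniformlyOn.differentiableOn_of_isOpen [LocallyCompactSpace E]
    [CompleteSpace F] {h : ι → E → F} {f : E → F} {l : Filter ι} [l.NeBot] {U : Set E} (hU : IsOpen U)
    (hf : TendstoLocallyUniformlyOn h f l U) (hd : ∀ k, DifferentiableOn ℂ (h k) U) :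
    DifferentiableOn ℂ f U := by
  intro x hx
  obtain ⟨K, hKx, hKU, hK⟩ := local_compact_nhds (hU.mem_nhds hx)
  have hfK := (tendstoLocallyUniformlyOn_iff_forall_isCompact hU).1 hf K hKU hK
  obtain ⟨R, hR, hball⟩ := Metric.mem_nhds_iff.1 hKx
  have hr : 0 < R / 2 := half_pos hR
  have hRK : ball x (2 * (R / 2)) ⊆ K := by rwa [mul_div_cancel₀ R two_ne_zero]
  have hrK : ball x (R / 2) ⊆ K := (ball_subset_ball (half_le_self hR.le)).trans hball
  have hc := UniformCauchySeqOn.fderiv_of_differentiableOn hr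
    (fun k => (hd k).mono (hRK.trans hKU)) (hfK.mono hRK).uniformCauchySeqOn
  have hlim : ∀ y ∈ ball x (R / 2), ∃ g', Tendsto (fun k => fderiv ℂ (h k) y) l (𝓝 g') :=
    fun y hy => cauchy_map_iff_exists_tendsto.1 (hc.cauchy_map hy)
  choose! g' hg' using hlim
  exact (hasFDerivAt_of_tendstoUniformlyOn isOpen_ball (hc.tendstoUniformlyOn_of_tendsto hg')
    (fun k y hy => ((hd k).differentiableAt (hU.mem_nhds (hKU (hrK hy)))).hasFDerivAt)
    (fun y hy => hfK.tendsto_at (hrK hy))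
    (mem_ball_self hr)).differentiableAt.differentiableWithinAt

end NormedSpace

/-- Osgood-type theorem of Krantz. A pointwise limit of
holomorphic functions on an open set `Ω ⊆ ℂⁿ` is holomorphic on a dense open
subset of `Ω`, and the convergence is uniform on compact subsets of that
open set. -/
theorem pointwise_limit_of_holomorphic
    (n : ℕ) (hn : 0 < n) (Ω : Set (Fin n → ℂ)) (hΩ : IsOpen Ω)
    (h : ℕ → (Fin n → ℂ) → ℂ) (hholo : ∀ k, DifferentiableOn ℂ (h k) Ω)
    (f : (Fin n → ℂ) → ℂ)
    (hconv : ∀ z ∈ Ω,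
      Filter.Tendsto (fun k => h k z) Filter.atTop (nhds (f z))) :
    ∃ U : Set (Fin n → ℂ), IsOpen U ∧ U ⊆ Ω ∧ Ω ⊆ closure U ∧
      DifferentiableOn ℂ f U ∧
      ∀ K : Set (Fin n → ℂ), K ⊆ U → IsCompact K →
        TendstoUniformlyOn h f Filter.atTop K := by
  have : BaireSpace Ω := hΩ.baireSpace
  obtain ⟨V, hVo, hVd, hVb⟩ := exists_isOpen_dense_locally_bounded
    (h := fun k (z : Ω) => h k z) (fun k => (hholo k).continuousOn.domRestrict)
    fun z => by
      obtain ⟨M, hM⟩ := (hconv z z.2).norm.bddAbove_range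
      exact ⟨M, fun k => hM (mem_range_self k)⟩
  have hUo : IsOpen ((↑) '' V : Set (Fin n → ℂ)) := hΩ.isOpenMap_subtype_val V hVo
  have hUΩ : ((↑) '' V : Set (Fin n → ℂ)) ⊆ Ω := Subtype.coe_image_subset Ω V
  have hequi : ∀ z ∈ ((↑) '' V : Set (Fin n → ℂ)), EquicontinuousAt h z := by
    rintro _ ⟨z, hz, rfl⟩
    obtain ⟨M, hM⟩ := hVb z hz
    refine equicontinuousAt_of_differentiableOn_of_bounded (hΩ.mem_nhds z.2) hholo (M := M) ?_
    rw [← map_nhds_subtype_coe_eq_nhds z.2 (hΩ.mem_nhds z.2)]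
    exact hM
  have hunif : ∀ K : Set (Fin n → ℂ), K ⊆ (↑) '' V → IsCompact K →
      TendstoUniformlyOn h f atTop K := by
    intro K hKU hK
    have hlim := (EquicontinuousOn.tendsto_uniformOnFun_iff_pi' (𝔖 := {K}) (F := h)
      (by simpa using hK)
      (by
        rintro _ rfl z hz
        exact (hequi z (hKU hz)).equicontinuousWithinAt _) atTop f).2 (by
        rw [tendsto_pi_nhds]
        rintro ⟨z, hz⟩
        exact hconv z (hUΩ (hKU (by simpa using hz))))
    exact UniformOnFun.tendsto_iff_tendstoUniformlyOn.1 hlim K rfl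
  refine ⟨_, hUo, hUΩ, Subtype.dense_iff.1 hVd, ?_, hunif⟩
  exact ((tendstoLocallyUniformlyOn_iff_forall_isCompact hUo).2 hunif).differentiableOn_of_isOpen
    hUo fun k => (hholo k).mono hUΩ
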